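/- Let a and a₀ be real numbers with a < a₀ ≤ 0, and let φ : (0,∞) → ℝ be differentiable with φ'(τ) ≤ (2/τ)·(φ(τ) − a₀) for every τ > 0. Assume there exists τ₀ > 0 such that φ(τ) > a for all τ ∈ (0, τ₀], and that φ(τ) → −∞ as τ → ∞. Then there exists a unique τ* > 0 such that φ(τ*) = a; moreover φ(τ) > a for all 0 < τ < τ*, and φ(τ) < a for all τ > τ*. -/

import Mathlib

open Filter

/-- If `φ' ≤ (2 / τ) (φ - c)` on the positive half-line, then `(φ - c) / τ ^ 2` is nonincreasing
there. -/
theorem antitoneOn_sub_div_sq {c : ℝ} {φ φ' : ℝ → ℝ}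
    (hderiv : ∀ τ, 0 < τ → HasDerivAt φ (φ' τ) τ)
    (hineq : ∀ τ, 0 < τ → φ' τ ≤ 2 / τ * (φ τ - c)) :
    AntitoneOn (fun τ => (φ τ - c) / τ ^ 2) (Set.Ioi 0) := by
  have hquot : ∀ τ : ℝ, 0 < τ → HasDerivAt (fun τ => (φ τ - c) / τ ^ 2)
      ((φ' τ * τ ^ 2 - (φ τ - c) * (2 * τ)) / (τ ^ 2) ^ 2) τ := fun τ hτ => by
    simpa using ((hderiv τ hτ).sub_const c).fun_div (hasDerivAt_pow 2 τ) (pow_pos hτ 2).ne'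
  refine antitoneOn_of_deriv_nonpos (convex_Ioi 0)
    (fun τ hτ => (hquot τ hτ).continuousAt.continuousWithinAt) ?_ ?_ <;>
    rw [interior_Ioi]
  · exact fun τ hτ => (hquot τ hτ).differentiableAt.differentiableWithinAt
  · intro τ hτ
    have hτ' : 0 < τ := hτ
    rw [(hquot τ hτ).deriv]
    refine div_nonpos_of_nonpos_of_nonneg ?_ (by positivity)
    have h := mul_le_mul_of_nonneg_right (hineq τ hτ) (sq_nonneg τ)
    have e : 2 / τ * (φ τ - c) * τ ^ 2 = (φ τ - c) * (2 * τ) := by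
      field_simp
    linarith

/-- Under `φ' ≤ (2 / τ) (φ - c)`, the function `φ` is strictly decreasing from any point where it
lies below `c`. -/
theorem lt_of_lt_of_deriv_le {c : ℝ} {φ φ' : ℝ → ℝ}
    (hderiv : ∀ τ, 0 < τ → HasDerivAt φ (φ' τ) τ)
    (hineq : ∀ τ, 0 < τ → φ' τ ≤ 2 / τ * (φ τ - c))
    {s t : ℝ} (hs : 0 < s) (hst : s < t) (hφ : φ s < c) : φ t < φ s := by
  have ht : 0 < t := hs.trans hst
  have h : (φ t - c) / t ^ 2 ≤ (φ s - c) / s ^ 2 :=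
    antitoneOn_sub_div_sq hderiv hineq hs ht hst.le
  rw [div_le_div_iff₀ (pow_pos ht 2) (pow_pos hs 2)] at h
  have hsq : s ^ 2 < t ^ 2 := pow_lt_pow_left₀ hst hs.le two_ne_zero
  have hlt : (φ s - c) * t ^ 2 < (φ s - c) * s ^ 2 :=
    mul_lt_mul_of_neg_left hsq (sub_neg.mpr hφ)
  linarith [lt_of_mul_lt_mul_right (h.trans_lt hlt) (sq_nonneg s)]

/-- Along each ray the functional crosses the level `a` exactly once,
transversally from above (key step in the computation of `C_q(Φ,∞)`). -/
theorem unique_crossing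
    (a a₀ : ℝ) (ha : a < a₀) (ha₀ : a₀ ≤ 0)
    (φ φ' : ℝ → ℝ)
    (hderiv : ∀ τ, 0 < τ → HasDerivAt φ (φ' τ) τ)
    (hineq : ∀ τ, 0 < τ → φ' τ ≤ 2 / τ * (φ τ - a₀))
    (hsmall : ∃ τ₀ > (0:ℝ), ∀ τ, 0 < τ → τ ≤ τ₀ → a < φ τ)
    (hinf : Tendsto φ atTop atBot) :
    ∃ τs > (0:ℝ), φ τs = a ∧ (∀ τ, 0 < τ → φ τ = a → τ = τs) ∧
      (∀ τ, 0 < τ → τ < τs → a < φ τ) ∧ (∀ τ, τs < τ → φ τ < a) := by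
  have hdecr : ∀ s t, 0 < s → s < t → φ s ≤ a → φ t < φ s := fun s t hs hst h =>
    lt_of_lt_of_deriv_le hderiv hineq hs hst (h.trans_lt ha)
  obtain ⟨τ₀, hτ₀, hgt⟩ := hsmall
  obtain ⟨T, hT, hτ₀T⟩ :=
    ((hinf.eventually_le_atBot a).and (eventually_ge_atTop τ₀)).exists
  have hcont : ContinuousOn φ (Set.Icc τ₀ T) := fun τ hτ =>
    (hderiv τ (hτ₀.trans_le hτ.1)).continuousAt.continuousWithinAt
  obtain ⟨τs, hτs, hφ⟩ :=
    intermediate_value_Icc' hτ₀T hcont ⟨hT, (hgt τ₀ hτ₀ le_rfl).le⟩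
  have hpos : 0 < τs := hτ₀.trans_le hτs.1
  have hbefore : ∀ τ, 0 < τ → τ < τs → a < φ τ := fun τ hτ hlt => by
    by_contra! h
    linarith [hdecr τ τs hτ hlt h]
  have hafter : ∀ τ, τs < τ → φ τ < a := fun τ hlt =>
    hφ ▸ hdecr τs τ hpos hlt hφ.le
  refine ⟨τs, hpos, hφ, fun τ hτ h => ?_, hbefore, hafter⟩
  rcases lt_trichotomy τ τs with hlt | heq | hlt
  · exact absurd h (hbefore τ hτ hlt).ne'
  · exact heq
  · exact absurd h (hafter τ hlt).ne
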